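/- Let W ⊆ ℝ^{4×4} × ℝ ≅ ℝ^17 be the union of: (1) the vectors (v, 0) where v belongs to the odd 16-dimensional kissing configuration; (2) the vectors (v, t) where t = √2 or t = −√2 and v has entries ±1 on the support of some weight-6 element of C₆, 0 elsewhere, with an odd number of entries equal to −1; and (3) the two vectors (0, √8) and (0, −√8). Then |W| = 5346, every w ∈ W has squared Euclidean norm 8, and any two distinct vectors in W have inner product at most 4. -/

import Mathlib

open scoped RealInnerProductSpace

/-- `C₁₀`: the set of `4×4` matrices over `𝔽₂` all of whose four row sums and
four column sums are equal to one common value in `𝔽₂`. -/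
def C10 : Set (Fin 4 × Fin 4 → ZMod 2) :=
  {m | ∃ s : ZMod 2, (∀ i : Fin 4, ∑ j : Fin 4, m (i, j) = s) ∧
        (∀ j : Fin 4, ∑ i : Fin 4, m (i, j) = s)}

/-- `C₆ = C₁₀^⊥`: the dual code of `C₁₀` under the standard bilinear form. -/
def C6 : Set (Fin 4 × Fin 4 → ZMod 2) :=
  {x | ∀ c ∈ C10, (∑ p : Fin 4 × Fin 4, x p * c p) = 0}

/-- The odd 16-dimensional kissing configuration in `ℝ^{4×4}`. -/
def oddConfig16 : Set (EuclideanSpace ℝ (Fin 4 × Fin 4)) :=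
  {w | (∃ p q : Fin 4 × Fin 4, p ≠ q ∧ (w p = 2 ∨ w p = -2) ∧ (w q = 2 ∨ w q = -2) ∧
          ∀ r : Fin 4 × Fin 4, r ≠ p → r ≠ q → w r = 0) ∨
       (∃ c ∈ C6, hammingNorm c = 8 ∧
          (∀ p : Fin 4 × Fin 4, c p ≠ 0 → (w p = 1 ∨ w p = -1)) ∧
          (∀ p : Fin 4 × Fin 4, c p = 0 → w p = 0) ∧
          Odd {p : Fin 4 × Fin 4 | w p = -1}.ncard)}

/-- The space `ℝ^{4×4} × ℝ ≅ ℝ^17` with the `L²` inner product. -/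
noncomputable abbrev Space17 : Type :=
  WithLp 2 (EuclideanSpace ℝ (Fin 4 × Fin 4) × ℝ)

/-- The pair `(v, t) ∈ ℝ^{4×4} × ℝ` as an element of `ℝ^17`. -/
noncomputable def pair17 (v : EuclideanSpace ℝ (Fin 4 × Fin 4)) (t : ℝ) : Space17 :=
  (WithLp.equiv 2 (EuclideanSpace ℝ (Fin 4 × Fin 4) × ℝ)).symm (v, t)

/-- The 17-dimensional base configuration `W ⊆ ℝ^{4×4} × ℝ`: the union of
(1) `(v, 0)` for `v` in the odd 16-dimensional kissing configuration;
(2) `(v, ±√2)` for `v` with entries `±1` on the support of some weight-6 element of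
`C₆`, `0` elsewhere, and an odd number of entries equal to `-1`; and
(3) `(0, ±√8)`. -/
def baseConfig17 : Set Space17 :=
  (fun v => pair17 v 0) '' oddConfig16 ∪
  {x | ∃ (v : EuclideanSpace ℝ (Fin 4 × Fin 4)) (t : ℝ),
        (t = Real.sqrt 2 ∨ t = -Real.sqrt 2) ∧
        (∃ c ∈ C6, hammingNorm c = 6 ∧
          (∀ p : Fin 4 × Fin 4, c p ≠ 0 → (v p = 1 ∨ v p = -1)) ∧
          (∀ p : Fin 4 × Fin 4, c p = 0 → v p = 0) ∧
          Odd {p : Fin 4 × Fin 4 | v p = -1}.ncard) ∧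
        x = pair17 v t} ∪
  {pair17 0 (Real.sqrt 8), pair17 0 (-Real.sqrt 8)}

abbrev P4 := Fin 4 × Fin 4
abbrev Par := (Fin 4 → ZMod 2) × (Fin 4 → ZMod 2)

/-- The codeword with entries `a i + b j`. -/
def word (x : Par) : P4 → ZMod 2 := fun p => x.1 p.1 + x.2 p.2

def supp (x : Par) : Finset P4 := Finset.univ.filter fun p => word x p ≠ 0

/-- Parameters of the codewords of weight `k`. -/
def KK (k : ℕ) : Finset Par :=
  Finset.univ.filter fun x => x.2 0 = 0 ∧ (∑ i, x.1 i) + (∑ i, x.2 i) = 0 ∧ (supp x).card = k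

theorem card_K8 : (KK 8).card = 30 := by decide +kernel
theorem card_K6 : (KK 6).card = 16 := by decide +kernel

theorem ov88 : ∀ x ∈ KK 8, ∀ y ∈ KK 8, x ≠ y → (supp x ∩ supp y).card ≤ 4 := by decide +kernel
theorem ov86 : ∀ x ∈ KK 8, ∀ y ∈ KK 6, (supp x ∩ supp y).card ≤ 4 := by decide +kernel
theorem ov66 : ∀ x ∈ KK 6, ∀ y ∈ KK 6, x ≠ y → (supp x ∩ supp y).card ≤ 2 := by decide +kernel

theorem supp_card {k : ℕ} {x : Par} (hx : x ∈ KK k) : (supp x).card = k := by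
  simp only [KK, Finset.mem_filter] at hx
  exact hx.2.2.2

theorem word_eq_of_supp {x y : P4 → ZMod 2} (h : ∀ p, x p ≠ 0 ↔ y p ≠ 0) : x = y := by
  funext p
  have := h p
  revert this
  generalize x p = u
  generalize y p = v
  revert u v
  decide

theorem supp_inj {k l : ℕ} {x y : Par} (hx : x ∈ KK k) (hy : y ∈ KK l) (h : supp x = supp y) :
    x = y := by
  simp only [KK, Finset.mem_filter] at hx hy
  have hw : word x = word y := by
    apply word_eq_of_supp
    intro p
    have : p ∈ supp x ↔ p ∈ supp y := by rw [h]
    simpa [supp] using this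
  have h1 : ∀ i, x.1 i = y.1 i := by
    intro i
    have := congrFun hw (i, 0)
    simpa [word, hx.2.1, hy.2.1] using this
  have h2 : ∀ i, x.2 i = y.2 i := by
    intro i
    have := congrFun hw (0, i)
    simpa [word, h1] using this
  exact Prod.ext (funext h1) (funext h2)

theorem word_mem_C6 (x : Par) (h : (∑ i, x.1 i) + (∑ i, x.2 i) = 0) : word x ∈ C6 := by
  rintro c ⟨s, hr, hc⟩
  have e : ∑ p : P4, word x p * c p =
      (∑ i, x.1 i * ∑ j, c (i, j)) + ∑ j, x.2 j * ∑ i, c (i, j) := by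
    simp only [word, add_mul, Finset.sum_add_distrib, Finset.mul_sum]
    rw [Fintype.sum_prod_type, Fintype.sum_prod_type_right]
  rw [e]
  simp only [hr, hc]
  rw [← Finset.sum_mul, ← Finset.sum_mul, ← add_mul, h, zero_mul]

theorem exists_of_mem_C6 (c : P4 → ZMod 2) (h : c ∈ C6) :
    ∃ x : Par, x.2 0 = 0 ∧ (∑ i, x.1 i) + (∑ i, x.2 i) = 0 ∧ c = word x := by
  have hrect : ∀ i j, c (i, j) = c (i, 0) + (c (0, j) + c (0, 0)) := by
    intro i j
    have := h (fun p => ((if p.1 = i then 1 else 0) + (if p.1 = 0 then 1 else 0)) *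
      ((if p.2 = j then 1 else 0) + (if p.2 = 0 then 1 else 0))) (by
        refine ⟨0, ?_, ?_⟩ <;> revert i j <;> decide)
    simp only [Fintype.sum_prod_type] at this
    simp only [← mul_assoc] at this
    simp only [mul_add, Finset.sum_add_distrib, mul_ite, mul_one, mul_zero,
      Finset.sum_ite_eq', Finset.mem_univ, if_true] at this
    revert this
    generalize c (i, j) = u
    generalize c (i, 0) = v
    generalize c (0, j) = w
    generalize c (0, 0) = z
    revert u v w z
    decide
  have hd := h (fun p => if p.1 = p.2 then 1 else 0) ⟨1, by decide, by decide⟩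
  refine ⟨(fun i => c (i, 0), fun j => c (0, j) + c (0, 0)), ?_, ?_, ?_⟩
  · exact CharTwo.add_self_eq_zero _
  · simp only [Fintype.sum_prod_type, mul_ite, mul_one, mul_zero,
      Finset.sum_ite_eq, Finset.mem_univ, if_true] at hd
    rw [← Finset.sum_add_distrib, ← hd]
    exact Finset.sum_congr rfl fun i _ => (hrect i i).symm
  · funext p
    exact hrect p.1 p.2

/-- Signed vector. -/
noncomputable def sv (a : ℝ) (c N : Finset P4) : EuclideanSpace ℝ P4 :=
  WithLp.toLp 2 fun p => if p ∈ N then -a else if p ∈ c then a else 0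

theorem sv_apply (a : ℝ) (c N : Finset P4) (p : P4) :
    sv a c N p = if p ∈ N then -a else if p ∈ c then a else 0 := rfl

theorem sv_inj {a : ℝ} (ha : 0 < a) {c N c' N' : Finset P4} (hN : N ⊆ c) (hN' : N' ⊆ c')
    (h : sv a c N = sv a c' N') : c = c' ∧ N = N' := by
  have key : ∀ p, (p ∈ c ↔ p ∈ c') ∧ (p ∈ N ↔ p ∈ N') := by
    intro p
    have hp : sv a c N p = sv a c' N' p := by rw [h]
    rw [sv_apply, sv_apply] at hp
    have h1 := @hN p
    have h2 := @hN' p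
    by_cases q1 : p ∈ N <;> by_cases q2 : p ∈ N' <;> by_cases q3 : p ∈ c <;>
      by_cases q4 : p ∈ c' <;> simp only [q1, q2, q3, q4, if_true, if_false] at hp h1 h2 ⊢ <;>
      first | tauto | (exfalso; linarith)
  exact ⟨Finset.ext fun p => (key p).1, Finset.ext fun p => (key p).2⟩

theorem inner_le (a b : ℝ) (ha : 0 < a) (hb : 0 < b) {c N c' N' : Finset P4} (hN : N ⊆ c)
    (hN' : N' ⊆ c') : ⟪sv a c N, sv b c' N'⟫ ≤ a * b * (c ∩ c').card := by
  have hab := mul_pos ha hb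
  rw [PiLp.inner_apply]
  have : (a * b * (c ∩ c').card) = ∑ p : P4, if p ∈ c ∩ c' then a * b else 0 := by
    rw [Finset.sum_ite_mem]; simp [mul_comm]
  rw [this]
  apply Finset.sum_le_sum
  intro p _
  simp only [sv_apply, Finset.mem_inter, RCLike.inner_apply, conj_trivial]
  have h1 := @hN p
  have h2 := @hN' p
  by_cases q1 : p ∈ N <;> by_cases q2 : p ∈ N' <;> by_cases q3 : p ∈ c <;>
      by_cases q4 : p ∈ c' <;> simp [q1, q2, q3, q4] at h1 h2 ⊢ <;> nlinarith

theorem inner_same (a : ℝ) {c N N' : Finset P4} (hN : N ⊆ c)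
    (hN' : N' ⊆ c) :
    ⟪sv a c N, sv a c N'⟫ = a * a * (c.card - 2 * ((N \ N').card + (N' \ N).card)) := by
  rw [PiLp.inner_apply]
  have e : ∀ s : Finset P4, (s.card : ℝ) = ∑ p : P4, if p ∈ s then 1 else 0 := by
    intro s; simp
  rw [e, e, e, ← Finset.sum_add_distrib, Finset.mul_sum, ← Finset.sum_sub_distrib, Finset.mul_sum]
  apply Finset.sum_congr rfl
  intro p _
  simp only [sv_apply, Finset.mem_sdiff, RCLike.inner_apply, conj_trivial]
  have h1 := @hN p
  have h2 := @hN' p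
  by_cases q1 : p ∈ N <;> by_cases q2 : p ∈ N' <;> by_cases q3 : p ∈ c <;>
      simp [q1, q2, q3] at h1 h2 ⊢ <;> ring

theorem inner_self' (a : ℝ) {c N : Finset P4} (hN : N ⊆ c) :
    ⟪sv a c N, sv a c N⟫ = a * a * c.card := by
  rw [inner_same a hN hN]; simp

theorem sdiff_pos {N N' : Finset P4} (h : N ≠ N') : 1 ≤ (N \ N').card + (N' \ N).card := by
  by_contra hh
  have h1 : (N \ N').card = 0 := by omega
  have h2 : (N' \ N).card = 0 := by omega
  rw [Finset.card_eq_zero, Finset.sdiff_eq_empty_iff_subset] at h1 h2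
  exact h (Finset.Subset.antisymm h1 h2)

theorem sdiff_odd {N N' : Finset P4} (h : N ≠ N') (o : Odd N.card) (o' : Odd N'.card) :
    2 ≤ (N \ N').card + (N' \ N).card := by
  have h0 := sdiff_pos h
  have h1 := Finset.card_sdiff_add_card_inter N N'
  have h2 := Finset.card_sdiff_add_card_inter N' N
  rw [Finset.inter_comm] at h2
  rw [Nat.odd_iff] at o o'
  omega

theorem inner_ne2 {c N N' : Finset P4} (hN : N ⊆ c) (hN' : N' ⊆ c) (hc : c.card = 2)
    (h : N ≠ N') : ⟪sv 2 c N, sv 2 c N'⟫ ≤ 4 := by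
  rw [inner_same 2 hN hN', hc]
  have : (1 : ℝ) ≤ (N \ N').card + (N' \ N).card := by exact_mod_cast sdiff_pos h
  push_cast
  linarith

theorem inner_ne1 {c N N' : Finset P4} (hN : N ⊆ c) (hN' : N' ⊆ c) 
    (o : Odd N.card) (o' : Odd N'.card)
    (h : N ≠ N') : ⟪sv 1 c N, sv 1 c N'⟫ ≤ c.card - 4 := by
  rw [inner_same 1 hN hN']
  have : (2 : ℝ) ≤ (N \ N').card + (N' \ N).card := by exact_mod_cast sdiff_odd h o o'
  linarith

/-- Index sets. -/
def I2 : Finset (Σ _ : Finset P4, Finset P4) :=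
  (Finset.powersetCard 2 Finset.univ).sigma fun c => c.powerset

def IK (k : ℕ) : Finset (Σ _ : Par, Finset P4) :=
  (KK k).sigma fun x => (supp x).powerset.filter fun N => Odd N.card

theorem card_I2 : I2.card = 480 := by
  rw [I2, Finset.card_sigma, Finset.sum_congr rfl (g := fun _ => 4)]
  · simp [Finset.card_powersetCard, Nat.choose]
  · intro c hc
    rw [Finset.mem_powersetCard] at hc
    rw [Finset.card_powerset, hc.2]; rfl

theorem card_odd (s : Finset P4) (hs : s.Nonempty) :
    2 * (s.powerset.filter fun N => Odd N.card).card = 2 ^ s.card := by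
  have h := Finset.sum_powerset_neg_one_pow_card_of_nonempty hs
  have e : ∀ N : Finset P4, ((-1 : ℤ)) ^ N.card = 1 - 2 * (if Odd N.card then 1 else 0) := by
    intro N
    split_ifs with ho
    · rw [ho.neg_one_pow]; norm_num
    · rw [(Nat.not_odd_iff_even.mp ho).neg_one_pow]; norm_num
  simp only [e, Finset.sum_sub_distrib, ← Finset.mul_sum, Finset.sum_boole] at h
  simp only [Finset.sum_const, Finset.card_powerset, nsmul_eq_mul, mul_one] at h
  zify
  push_cast at h
  linarith

theorem card_IK (k : ℕ) : (IK (k + 1)).card = (KK (k + 1)).card * 2 ^ k := by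
  rw [IK, Finset.card_sigma, Finset.sum_congr rfl (g := fun _ => 2 ^ k)]
  · simp
  · intro x hx
    have h1 := supp_card hx
    have h2 := card_odd (supp x) (by rw [← Finset.card_pos]; omega)
    rw [h1, pow_succ] at h2
    omega

theorem mem_IK {k : ℕ} {i : Σ _ : Par, Finset P4} :
    i ∈ IK k ↔ i.1 ∈ KK k ∧ i.2 ⊆ supp i.1 ∧ Odd i.2.card := by
  simp [IK]

theorem mem_I2 {i : Σ _ : Finset P4, Finset P4} :
    i ∈ I2 ↔ i.1.card = 2 ∧ i.2 ⊆ i.1 := by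
  simp [I2, Finset.mem_powersetCard]

attribute [irreducible] I2 IK

theorem code_iff (k : ℕ) (v : EuclideanSpace ℝ P4) :
    (∃ c ∈ C6, hammingNorm c = k ∧
          (∀ p : Fin 4 × Fin 4, c p ≠ 0 → (v p = 1 ∨ v p = -1)) ∧
          (∀ p : Fin 4 × Fin 4, c p = 0 → v p = 0) ∧
          Odd {p : Fin 4 × Fin 4 | v p = -1}.ncard) ↔
    ∃ i ∈ IK k, v = sv 1 (supp i.1) i.2 := by
  classical
  constructor
  · rintro ⟨c, hc, hk, h1, h0, ho⟩
    obtain ⟨x, hx0, hxs, rfl⟩ := exists_of_mem_C6 c hc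
    refine ⟨⟨x, Finset.univ.filter fun p => v p = -1⟩, ?_, ?_⟩
    · rw [mem_IK]
      refine ⟨?_, ?_, ?_⟩
      · simp only [KK, Finset.mem_filter, Finset.mem_univ, true_and]
        exact ⟨hx0, hxs, hk⟩
      · intro p hp
        simp only [supp, Finset.mem_filter, Finset.mem_univ, true_and] at hp ⊢
        intro hz
        rw [h0 p hz] at hp
        norm_num at hp
      · rw [← Set.ncard_coe_finset]
        simpa using ho
    · ext p
      rw [sv_apply]
      simp only [supp, Finset.mem_filter, Finset.mem_univ, true_and]
      by_cases hz : word x p = 0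
      · rw [h0 p hz]; simp [hz]
      · rcases h1 p hz with h | h <;> rw [h] <;> norm_num [hz]
  · rintro ⟨⟨x, N⟩, hi, rfl⟩
    rw [mem_IK] at hi
    obtain ⟨hx, hN, ho⟩ := hi
    simp only at hx hN ho
    have hx' := hx
    simp only [KK, Finset.mem_filter, Finset.mem_univ, true_and] at hx'
    refine ⟨word x, word_mem_C6 x hx'.2.1, hx'.2.2, ?_, ?_, ?_⟩
    · intro p hp
      rw [sv_apply]
      have : p ∈ supp x := by simp [supp, hp]
      by_cases q : p ∈ N <;> simp [q, this]
    · intro p hp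
      rw [sv_apply]
      have : p ∉ supp x := by simp [supp, hp]
      have h2 : p ∉ N := fun h => this (hN h)
      simp [this, h2]
    · have : {p : Fin 4 × Fin 4 | sv 1 (supp x) N p = -1} = ↑N := by
        ext p
        simp only [Set.mem_ofPred_eq, sv_apply, Finset.mem_coe]
        by_cases q : p ∈ N <;> by_cases q' : p ∈ supp x <;> norm_num [q, q']
      rw [this, Set.ncard_coe_finset]
      exact ho

theorem two_iff (w : EuclideanSpace ℝ P4) :
    (∃ p q : Fin 4 × Fin 4, p ≠ q ∧ (w p = 2 ∨ w p = -2) ∧ (w q = 2 ∨ w q = -2) ∧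
          ∀ r : Fin 4 × Fin 4, r ≠ p → r ≠ q → w r = 0) ↔
    ∃ i ∈ I2, w = sv 2 i.1 i.2 := by
  classical
  constructor
  · rintro ⟨p, q, hpq, hp, hq, h0⟩
    refine ⟨⟨{p, q}, Finset.univ.filter fun r => w r = -2⟩, ?_, ?_⟩
    · rw [mem_I2]
      refine ⟨Finset.card_pair hpq, ?_⟩
      intro r hr
      simp only [Finset.mem_filter, Finset.mem_univ, true_and, Finset.mem_insert,
        Finset.mem_singleton] at hr ⊢
      by_contra hh
      push Not at hh
      rw [h0 r hh.1 hh.2] at hr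
      norm_num at hr
    · ext r
      rw [sv_apply]
      simp only [Finset.mem_filter, Finset.mem_univ, true_and, Finset.mem_insert,
        Finset.mem_singleton]
      by_cases h1 : r = p
      · subst h1
        rcases hp with h | h <;> rw [h] <;> norm_num
      by_cases h2 : r = q
      · subst h2
        rcases hq with h | h <;> rw [h] <;> norm_num
      rw [h0 r h1 h2]
      norm_num [h1, h2]
  · rintro ⟨⟨c, N⟩, hi, rfl⟩
    rw [mem_I2] at hi
    obtain ⟨hc, hN⟩ := hi
    simp only at hc hN
    obtain ⟨p, q, hpq, rfl⟩ := Finset.card_eq_two.mp hc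
    refine ⟨p, q, hpq, ?_, ?_, ?_⟩
    · rw [sv_apply]; by_cases h : p ∈ N <;> simp [h]
    · rw [sv_apply]; by_cases h : q ∈ N <;> simp [h]
    · intro r h1 h2
      have h3 : r ∉ ({p, q} : Finset P4) := by simp [h1, h2]
      have h4 : r ∉ N := fun h => h3 (hN h)
      rw [sv_apply]; simp [h3, h4]

theorem pair17_inj {v v' : EuclideanSpace ℝ P4} {t t' : ℝ} (h : pair17 v t = pair17 v' t') :
    v = v' ∧ t = t' := by
  simpa [pair17] using h

theorem pair17_inner (v v' : EuclideanSpace ℝ P4) (t t' : ℝ) :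
    ⟪pair17 v t, pair17 v' t'⟫ = ⟪v, v'⟫ + t * t' := by
  simp [pair17, WithLp.prod_inner_apply, mul_comm]

open Classical in
noncomputable def G2 : Finset Space17 := I2.image fun i => pair17 (sv 2 i.1 i.2) 0
open Classical in
noncomputable def GK (k : ℕ) (t : ℝ) : Finset Space17 :=
  (IK k).image fun i => pair17 (sv 1 (supp i.1) i.2) t

theorem card_G2 : G2.card = 480 := by
  rw [G2, Finset.card_image_of_injOn, card_I2]
  rintro ⟨c, N⟩ hi ⟨c', N'⟩ hi' h
  rw [Finset.mem_coe, mem_I2] at hi hi'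
  obtain ⟨rfl, rfl⟩ := sv_inj two_pos hi.2 hi'.2 (pair17_inj h).1
  rfl

theorem card_GK (k : ℕ) (t : ℝ) : (GK k t).card = (IK k).card := by
  rw [GK, Finset.card_image_of_injOn]
  rintro ⟨c, N⟩ hi ⟨c', N'⟩ hi' h
  rw [Finset.mem_coe, mem_IK] at hi hi'
  obtain ⟨h1, h2⟩ := sv_inj one_pos hi.2.1 hi'.2.1 (pair17_inj h).1
  have := supp_inj hi.1 hi'.1 h1
  simp only at this h2
  subst this h2
  rfl

/-- Normal forms for elements of the configuration. -/
theorem mem_base (w : Space17) : w ∈ baseConfig17 ↔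
    (((w ∈ G2 ∨ w ∈ GK 8 0) ∨ w ∈ GK 6 (√2)) ∨ w ∈ GK 6 (-√2)) ∨
      w = pair17 0 (√8) ∨ w = pair17 0 (-√8) := by
  classical
  simp only [baseConfig17, Set.mem_union, Set.mem_image, Set.mem_ofPred_eq, oddConfig16, code_iff,
    two_iff, Set.mem_insert_iff, Set.mem_singleton_iff, G2, GK, Finset.mem_image]
  constructor
  · rintro ((⟨v, (⟨i, hi, rfl⟩ | ⟨i, hi, rfl⟩), rfl⟩ | ⟨v, t, (rfl | rfl), ⟨i, hi, rfl⟩, rfl⟩) | h)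
    · exact Or.inl (Or.inl (Or.inl (Or.inl ⟨i, hi, rfl⟩)))
    · exact Or.inl (Or.inl (Or.inl (Or.inr ⟨i, hi, rfl⟩)))
    · exact Or.inl (Or.inl (Or.inr ⟨i, hi, rfl⟩))
    · exact Or.inl (Or.inr ⟨i, hi, rfl⟩)
    · exact Or.inr h
  · rintro ((((⟨i, hi, rfl⟩ | ⟨i, hi, rfl⟩) | ⟨i, hi, rfl⟩) | ⟨i, hi, rfl⟩) | h)
    · exact Or.inl (Or.inl ⟨_, Or.inl ⟨i, hi, rfl⟩, rfl⟩)
    · exact Or.inl (Or.inl ⟨_, Or.inr ⟨i, hi, rfl⟩, rfl⟩)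
    · exact Or.inl (Or.inr ⟨_, _, Or.inl rfl, ⟨i, hi, rfl⟩, rfl⟩)
    · exact Or.inl (Or.inr ⟨_, _, Or.inr rfl, ⟨i, hi, rfl⟩, rfl⟩)
    · exact Or.inr h

theorem mem_G2 {w : Space17} : w ∈ G2 ↔
    ∃ c N : Finset P4, c.card = 2 ∧ N ⊆ c ∧ w = pair17 (sv 2 c N) 0 := by
  classical
  simp only [G2, Finset.mem_image, mem_I2]
  constructor
  · rintro ⟨⟨c, N⟩, ⟨h1, h2⟩, rfl⟩
    exact ⟨c, N, h1, h2, rfl⟩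
  · rintro ⟨c, N, h1, h2, rfl⟩
    exact ⟨⟨c, N⟩, ⟨h1, h2⟩, rfl⟩

theorem mem_GK {k : ℕ} {t : ℝ} {w : Space17} : w ∈ GK k t ↔
    ∃ x N, x ∈ KK k ∧ N ⊆ supp x ∧ Odd N.card ∧ w = pair17 (sv 1 (supp x) N) t := by
  classical
  simp only [GK, Finset.mem_image, mem_IK]
  constructor
  · rintro ⟨⟨c, N⟩, ⟨h1, h2, h3⟩, rfl⟩
    exact ⟨c, N, h1, h2, h3, rfl⟩
  · rintro ⟨c, N, h1, h2, h3, rfl⟩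
    exact ⟨⟨c, N⟩, ⟨h1, h2, h3⟩, rfl⟩

attribute [irreducible] G2 GK

theorem snd_G2 {w : Space17} (h : w ∈ G2) : w.snd = 0 := by
  obtain ⟨c, N, -, -, rfl⟩ := mem_G2.mp h
  rfl

theorem snd_GK {k : ℕ} {t : ℝ} {w : Space17} (h : w ∈ GK k t) : w.snd = t := by
  obtain ⟨c, N, -, -, -, rfl⟩ := mem_GK.mp h
  rfl

theorem disj_2K {t : ℝ} {k : ℕ} {w : Space17} (h : w ∈ G2) (h' : w ∈ GK k t) : False := by
  obtain ⟨c, N, hc, -, rfl⟩ := mem_G2.mp h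
  obtain ⟨x, N', -, -, -, e⟩ := mem_GK.mp h'
  have e1 := (pair17_inj e).1
  obtain ⟨p, hp⟩ := Finset.card_pos.mp (by omega : 0 < c.card)
  have e2 : sv 2 c N p = sv 1 (supp x) N' p := by rw [e1]
  rw [sv_apply, sv_apply, if_pos hp] at e2
  split_ifs at e2 <;> norm_num at e2

theorem base_card : baseConfig17.ncard = 5346 := by
  classical
  have e : baseConfig17 = ↑((((G2 ∪ GK 8 0) ∪ GK 6 (√2)) ∪ GK 6 (-√2)) ∪
      {pair17 0 (√8), pair17 0 (-√8)}) := by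
    ext w
    rw [mem_base]
    simp only [Finset.mem_coe, Finset.mem_union, Finset.mem_insert, Finset.mem_singleton]
  have p2 : 0 < √2 := by positivity
  have p8 : √2 < √8 := Real.sqrt_lt_sqrt (by norm_num) (by norm_num)
  rw [e, Set.ncard_coe_finset, Finset.card_union_of_disjoint, Finset.card_union_of_disjoint,
    Finset.card_union_of_disjoint, Finset.card_union_of_disjoint, card_G2, card_GK, card_GK,
    card_GK, card_IK, card_IK, card_K8, card_K6, Finset.card_pair]
  · norm_num
  · intro h
    have := (pair17_inj h).2
    linarith
  · rw [Finset.disjoint_left]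
    exact fun w h h' => disj_2K h h'
  · rw [Finset.disjoint_left]
    intro w h h'
    have := snd_GK h'
    rcases Finset.mem_union.mp h with h | h
    · rw [snd_G2 h] at this; linarith
    · rw [snd_GK h] at this; linarith
  · rw [Finset.disjoint_left]
    intro w h h'
    have := snd_GK h'
    simp only [Finset.mem_union] at h
    rcases h with (h | h) | h
    · rw [snd_G2 h] at this; linarith
    · rw [snd_GK h] at this; linarith
    · rw [snd_GK h] at this; linarith
  · rw [Finset.disjoint_left]
    intro w h h'
    have : w.snd = √8 ∨ w.snd = -√8 := by
      simp only [Finset.mem_insert, Finset.mem_singleton] at h'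
      rcases h' with rfl | rfl
      · exact Or.inl rfl
      · exact Or.inr rfl
    simp only [Finset.mem_union] at h
    rcases h with ((h | h) | h) | h
    · rw [snd_G2 h] at this; rcases this with h | h <;> linarith
    · rw [snd_GK h] at this; rcases this with h | h <;> linarith
    · rw [snd_GK h] at this; rcases this with h | h <;> linarith
    · rw [snd_GK h] at this; rcases this with h | h <;> linarith

/-- The three shapes of vectors. -/
theorem shape {w : Space17} (h : w ∈ baseConfig17) :
    (∃ c N : Finset P4, c.card = 2 ∧ N ⊆ c ∧ w = pair17 (sv 2 c N) 0) ∨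
    (∃ x N, x ∈ KK 8 ∧ N ⊆ supp x ∧ Odd N.card ∧ w = pair17 (sv 1 (supp x) N) 0) ∨
    (∃ x N t, (t = √2 ∨ t = -√2) ∧ x ∈ KK 6 ∧ N ⊆ supp x ∧ Odd N.card ∧
      w = pair17 (sv 1 (supp x) N) t) ∨
    (∃ t, (t = √8 ∨ t = -√8) ∧ w = pair17 0 t) := by
  rw [mem_base, mem_G2, mem_GK, mem_GK, mem_GK] at h
  rcases h with (((h | h) | ⟨x, N, h⟩) | ⟨x, N, h⟩) | (h | h)
  · exact Or.inl h
  · exact Or.inr (Or.inl h)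
  · exact Or.inr (Or.inr (Or.inl ⟨x, N, _, Or.inl rfl, h⟩))
  · exact Or.inr (Or.inr (Or.inl ⟨x, N, _, Or.inr rfl, h⟩))
  · exact Or.inr (Or.inr (Or.inr ⟨_, Or.inl rfl, h⟩))
  · exact Or.inr (Or.inr (Or.inr ⟨_, Or.inr rfl, h⟩))

theorem base_norm (w : Space17) (h : w ∈ baseConfig17) : ‖w‖ ^ 2 = 8 := by
  rw [← real_inner_self_eq_norm_sq]
  have s2 : √2 * √2 = 2 := Real.mul_self_sqrt (by norm_num)
  have s8 : √8 * √8 = 8 := Real.mul_self_sqrt (by norm_num)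
  rcases shape h with ⟨c, N, hc, hN, rfl⟩ | ⟨x, N, hx, hN, -, rfl⟩ | ⟨x, N, t, ht, hx, hN, -, rfl⟩ |
    ⟨t, ht, rfl⟩
  · rw [pair17_inner, inner_self' _ hN, hc]; norm_num
  · rw [pair17_inner, inner_self' _ hN, supp_card hx]; norm_num
  · rw [pair17_inner, inner_self' _ hN, supp_card hx]
    rcases ht with rfl | rfl <;> norm_num
  · rw [pair17_inner, inner_zero_left]
    rcases ht with rfl | rfl <;> norm_num

theorem inner_le_of (a b : ℝ) (n : ℕ) (ha : 0 < a) (hb : 0 < b) {c N c' N' : Finset P4}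
    (hN : N ⊆ c) (hN' : N' ⊆ c') (h : (c ∩ c').card ≤ n) :
    ⟪sv a c N, sv b c' N'⟫ ≤ a * b * n := by
  refine (inner_le a b ha hb hN hN').trans ?_
  gcongr

theorem card_inter_two {c c' : Finset P4} (h : c.card = 2) (h' : c'.card = 2) (hne : c ≠ c') :
    (c ∩ c').card ≤ 1 := by
  by_contra hh
  have h1 : c ∩ c' = c := Finset.eq_of_subset_of_card_le Finset.inter_subset_left (by omega)
  have h2 : c ∩ c' = c' := Finset.eq_of_subset_of_card_le Finset.inter_subset_right (by omega)
  exact hne (h1.symm.trans h2)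

theorem base_inner (v : Space17) (hv : v ∈ baseConfig17) (w : Space17) (hw : w ∈ baseConfig17)
    (hne : v ≠ w) : ⟪v, w⟫ ≤ 4 := by
  have s2 : √2 * √2 = 2 := Real.mul_self_sqrt (by norm_num)
  have s8 : √8 * √8 = 8 := Real.mul_self_sqrt (by norm_num)
  have s28 : √2 * √8 = 4 := by
    rw [← Real.sqrt_mul (by norm_num), show (2 * 8 : ℝ) = 4 ^ 2 by norm_num,
      Real.sqrt_sq (by norm_num)]
  rcases shape hv with ⟨c, N, hc, hN, rfl⟩ | ⟨x, N, hx, hN, ho, rfl⟩ |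
    ⟨x, N, t, ht, hx, hN, ho, rfl⟩ | ⟨t, ht, rfl⟩ <;>
  rcases shape hw with ⟨c', N', hc', hN', rfl⟩ | ⟨x', N', hx', hN', ho', rfl⟩ |
    ⟨x', N', t', ht', hx', hN', ho', rfl⟩ | ⟨t', ht', rfl⟩ <;>
  rw [pair17_inner]
  · by_cases hcc : c = c'
    · subst hcc
      have hNN : N ≠ N' := by rintro rfl; exact hne rfl
      have := inner_ne2 hN hN' hc hNN
      linarith
    · have := inner_le_of 2 2 1 two_pos two_pos hN hN' (card_inter_two hc hc' hcc)
      norm_num at this ⊢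
      exact this
  · have := inner_le_of 2 1 2 two_pos one_pos hN hN'
      ((Finset.card_le_card Finset.inter_subset_left).trans hc.le)
    norm_num at this ⊢
    exact this
  · have := inner_le_of 2 1 2 two_pos one_pos hN hN'
      ((Finset.card_le_card Finset.inter_subset_left).trans hc.le)
    norm_num at this ⊢
    exact this
  · simp
  · have := inner_le_of 1 2 2 one_pos two_pos hN hN'
      ((Finset.card_le_card Finset.inter_subset_right).trans hc'.le)
    norm_num at this ⊢
    exact this
  · by_cases hcc : x = x'
    · subst hcc
      have hNN : N ≠ N' := by rintro rfl; exact hne rfl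
      have := inner_ne1 hN hN' ho ho' hNN
      rw [supp_card hx] at this
      norm_num at this ⊢
      exact this
    · have := inner_le_of 1 1 4 one_pos one_pos hN hN' (ov88 x hx x' hx' hcc)
      norm_num at this ⊢
      exact this
  · have := inner_le_of 1 1 4 one_pos one_pos hN hN' (ov86 x hx x' hx')
    norm_num at this ⊢
    exact this
  · simp
  · have := inner_le_of 1 2 2 one_pos two_pos hN hN'
      ((Finset.card_le_card Finset.inter_subset_right).trans hc'.le)
    norm_num at this ⊢
    exact this
  · have := inner_le_of 1 1 4 one_pos one_pos hN hN'
      (by rw [Finset.inter_comm]; exact ov86 x' hx' x hx)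
    norm_num at this ⊢
    exact this
  · have htt : t * t' ≤ 2 := by
      rcases ht with rfl | rfl <;> rcases ht' with rfl | rfl <;> nlinarith
    by_cases hcc : x = x'
    · subst hcc
      by_cases hNN : N = N'
      · subst hNN
        have htt' : t * t' = -2 := by
          rcases ht with rfl | rfl <;> rcases ht' with rfl | rfl
          · exact absurd rfl hne
          · linarith
          · linarith
          · exact absurd rfl hne
        rw [inner_self' _ hN, supp_card hx, htt']
        norm_num
      · have := inner_ne1 hN hN' ho ho' hNN
        rw [supp_card hx] at this
        norm_num at this
        linarith
    · have := inner_le_of 1 1 2 one_pos one_pos hN hN' (ov66 x hx x' hx' hcc)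
      norm_num at this
      linarith
  · rw [inner_zero_right]
    rcases ht with rfl | rfl <;> rcases ht' with rfl | rfl <;> linarith
  · simp
  · simp
  · rw [inner_zero_left]
    rcases ht with rfl | rfl <;> rcases ht' with rfl | rfl <;> linarith
  · rw [inner_zero_left]
    rcases ht with rfl | rfl <;> rcases ht' with rfl | rfl
    · exact absurd rfl hne
    · linarith
    · linarith
    · exact absurd rfl hne

/-- The 17-dimensional base configuration `W` has 5346 vectors, each of squared
Euclidean norm 8, and any two distinct vectors in it have inner product at most 4. -/
theorem baseConfig17_card_norm_inner :
    baseConfig17.ncard = 5346 ∧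
    (∀ w ∈ baseConfig17, ‖w‖ ^ 2 = 8) ∧
    (∀ v ∈ baseConfig17, ∀ w ∈ baseConfig17, v ≠ w → ⟪v, w⟫ ≤ 4) := by
  exact ⟨base_card, base_norm, base_inner⟩
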